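/- Let $A$ be a nonsingular $n \times n$ integer matrix, $p$ a prime, $e \ge 1$, and let $s$ be the least positive integer such that $s \cdot A^{-1}$ has integer entries (the greatest Smith invariant factor of $A$), with $k = v_p(s)$ the $p$-adic valuation of $s$. Let $H$ be an $n \times n$ upper triangular integer matrix with nonzero determinant whose rows generate the $\mathbb{Z}$-submodule $p^e\,\mathbb{Z}^n + R(A)$ of $\mathbb{Z}^n$. Then every diagonal entry $H_{ii}$ divides $p^{\min(e,k)}$. -/

import Mathlib

/-- Diagonal entries of the `p^e`-modular HNF of `A` divide `p^(min e k)` where `k` is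
the `p`-adic valuation of the greatest Smith invariant factor `s` of `A`. -/
theorem diag_modular_hnf_dvd_prime_pow (n : ℕ) (A : Matrix (Fin n) (Fin n) ℤ)
    (hA : A.det ≠ 0) (p : ℕ) (hp : p.Prime) (e : ℕ) (he : 1 ≤ e) (s : ℕ)
    (hs : IsLeast {t : ℕ | 0 < t ∧
      ∀ i j : Fin n, ∃ z : ℤ, (t : ℚ) * (A.map (Int.cast : ℤ → ℚ))⁻¹ i j = (z : ℚ)} s)
    (k : ℕ) (hk : k = padicValNat p s)
    (H : Matrix (Fin n) (Fin n) ℤ)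
    (htri : ∀ i j : Fin n, j < i → H i j = 0) (hdetH : H.det ≠ 0)
    (hspan : Submodule.span ℤ (Set.range H) =
      Submodule.span ℤ
          (Set.range (fun i : Fin n => ((p : ℤ) ^ e • Pi.single i 1 : Fin n → ℤ))) ⊔
        Submodule.span ℤ (Set.range A)) :
    ∀ i : Fin n, H i i ∣ (p : ℤ) ^ (min e k) := by
  classical
  obtain ⟨⟨hs0, hsA⟩, -⟩ := hs
  intro i
  have hHdiag : ∀ j, H j j ≠ 0 := by
    have h1 : H.det = ∏ j, H j j := Matrix.det_of_upperTriangular (fun a b hab => htri a b hab)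
    rw [h1] at hdetH
    intro j
    exact Finset.prod_ne_zero_iff.mp hdetH j (Finset.mem_univ j)
  have hpmem : ((p : ℤ) ^ e • Pi.single i 1 : Fin n → ℤ) ∈ Submodule.span ℤ (Set.range H) := by
    rw [hspan]
    exact Submodule.mem_sup_left (Submodule.subset_span ⟨i, rfl⟩)
  have hsmem : ((s : ℤ) • Pi.single i 1 : Fin n → ℤ) ∈ Submodule.span ℤ (Set.range H) := by
    rw [hspan]
    apply Submodule.mem_sup_right
    choose B hB using hsA
    have hdet : IsUnit (A.map (Int.cast : ℤ → ℚ)).det := by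
      have : (A.map (Int.cast : ℤ → ℚ)).det = (A.det : ℚ) := by
        have := (Int.castRingHom ℚ).map_det A
        simpa using this.symm
      rw [this]
      exact isUnit_iff_ne_zero.mpr (by exact_mod_cast hA)
    have hmul := Matrix.nonsing_inv_mul _ hdet
    have : ((s : ℤ) • Pi.single i 1 : Fin n → ℤ) = ∑ l, B i l • A l := by
      funext j
      have h2 := congrFun (congrFun hmul i) j
      rw [Matrix.mul_apply] at h2
      have h3 : ((∑ l, B i l * A l j : ℤ) : ℚ) = s * (1 : Matrix (Fin n) (Fin n) ℚ) i j := by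
        rw [← h2, Finset.mul_sum]
        push_cast
        refine Finset.sum_congr rfl fun l _ => ?_
        rw [← hB i l, Matrix.map_apply, mul_assoc]
      have h4 : (∑ l, B i l * A l j : ℤ) = s * (1 : Matrix (Fin n) (Fin n) ℤ) i j := by
        have h5 : ((∑ l, B i l * A l j : ℤ) : ℚ)
            = ((s * (1 : Matrix (Fin n) (Fin n) ℤ) i j : ℤ) : ℚ) := by
          rw [h3]
          by_cases hij : i = j
          · subst hij; simp
          · simp [Matrix.one_apply_ne hij]
        exact_mod_cast h5
      simp only [Finset.sum_apply, Pi.smul_apply, smul_eq_mul]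
      rw [h4]
      by_cases hij : i = j
      · subst hij; simp
      · simp [Matrix.one_apply_ne hij, Pi.single_eq_of_ne (Ne.symm hij)]
    rw [this]
    exact Submodule.sum_mem _ fun l _ => Submodule.smul_mem _ _ (Submodule.subset_span ⟨l, rfl⟩)
  have hg : Nat.gcd s (p ^ e) ∣ p ^ min e k := by
    obtain ⟨f, hf, hgf⟩ := (Nat.dvd_prime_pow hp).mp (Nat.gcd_dvd_right s (p ^ e))
    rw [hgf]
    apply pow_dvd_pow
    refine le_min hf ?_
    haveI := Fact.mk hp
    have : p ^ f ∣ s := hgf ▸ Nat.gcd_dvd_left s (p ^ e)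
    rw [hk]
    exact (padicValNat_dvd_iff_le hs0.ne').mp this
  have hgmem : (((Nat.gcd s (p ^ e) : ℕ) : ℤ) • Pi.single i 1 : Fin n → ℤ)
      ∈ Submodule.span ℤ (Set.range H) := by
    rw [Nat.gcd_eq_gcd_ab, add_smul]
    refine Submodule.add_mem _ ?_ ?_
    · rw [mul_comm, mul_smul]; exact Submodule.smul_mem _ _ hsmem
    · rw [mul_comm, mul_smul]
      refine Submodule.smul_mem _ _ ?_
      push_cast
      exact hpmem
  obtain ⟨c, hc⟩ := (Submodule.mem_span_range_iff_exists_fun ℤ).mp hgmem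
  have hcj : ∀ j, ∑ l, c l * H l j
      = ((Nat.gcd s (p ^ e) : ℕ) : ℤ) * (Pi.single i 1 : Fin n → ℤ) j := by
    intro j
    have := congrFun hc j
    simpa only [Finset.sum_apply, Pi.smul_apply, smul_eq_mul] using this
  have hsum : ∀ j, (∀ l, l < j → c l = 0) → ∑ l, c l * H l j = c j * H j j := by
    intro j hj
    refine Finset.sum_eq_single j (fun l _ hl => ?_) (by simp)
    rcases lt_or_gt_of_ne hl with h | h
    · rw [hj l h, zero_mul]
    · rw [htri l j h, mul_zero]
  have hc0 : ∀ j, j < i → c j = 0 := by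
    intro j
    induction j using WellFoundedLT.induction with
    | ind j ih =>
      intro hji
      have h1 := hsum j (fun l hl => ih l hl (hl.trans hji))
      rw [hcj j, Pi.single_eq_of_ne hji.ne, mul_zero] at h1
      exact (mul_eq_zero.mp h1.symm).resolve_right (hHdiag j)
  have h1 := hsum i hc0
  rw [hcj i, Pi.single_eq_same, mul_one] at h1
  have h2 : H i i ∣ ((Nat.gcd s (p ^ e) : ℕ) : ℤ) := ⟨c i, by rw [h1, mul_comm]⟩
  exact h2.trans (by exact_mod_cast hg)
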